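/- Let A be a σ-finite AW*-algebra. Then A is normal: for every nonempty upward-directed set P of projections of A (i.e., for any p, q ∈ P there is r ∈ P with p ≤ r and q ≤ r) there exists a self-adjoint element s ∈ A which is the least upper bound of P within the set of self-adjoint elements of A, ordered by the positive cone. -/

import Mathlib

variable {A : Type*} [CStarAlgebra A] [PartialOrder A] [StarOrderedRing A]

/-- A unital C*-algebra is an AW*-algebra if the right annihilator of every subset is
generated, as a right ideal, by a projection. -/
def IsAWStar (A : Type*) [CStarAlgebra A] : Prop :=
  ∀ S : Set A, ∃ p : A, star p = p ∧ p * p = p ∧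
    ∀ a : A, (∀ s ∈ S, s * a = 0) ↔ ∃ b : A, a = p * b

/-- An algebra is σ-finite if every family of pairwise orthogonal nonzero projections
is countable. -/
def SigmaFiniteAlg (A : Type*) [CStarAlgebra A] : Prop :=
  ∀ P : Set A, (∀ p ∈ P, star p = p ∧ p * p = p ∧ p ≠ 0) →
    (∀ p ∈ P, ∀ q ∈ P, p ≠ q → p * q = 0) → P.Countable


section Basics

omit [PartialOrder A] [StarOrderedRing A] in
/-- In an AW*-algebra every set has a right support projection. -/
theorem IsAWStar.exists_support (hAW : IsAWStar A) (S : Set A) :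
    ∃ e : A, IsStarProjection e ∧ (∀ a, (∀ s ∈ S, s * a = 0) ↔ e * a = 0) ∧ ∀ s ∈ S, s * e = s := by
  obtain ⟨p, hp, hpp, h⟩ := hAW S
  have hproj : IsStarProjection p := ⟨hpp, hp⟩
  refine ⟨1 - p, hproj.one_sub, fun a ↦ ?_, fun s hs ↦ ?_⟩
  · rw [h, sub_mul, one_mul, sub_eq_zero]
    refine ⟨?_, fun h ↦ ⟨a, h⟩⟩
    rintro ⟨b, rfl⟩
    rw [← mul_assoc, hpp]
  · have : s * p = 0 := (h p).2 ⟨p, hpp.symm⟩ s hs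
    rw [mul_sub, mul_one, this, sub_zero]

theorem mul_left_of {R : Type*} [Semigroup R] {x y z : R} (h : x * y = z) (w : R) :
    x * (y * w) = z * w := by
  rw [← mul_assoc, h]

theorem le_of_forall_le_add_smul {a b : A} (c : A) (h : ∀ ε : ℝ, 0 < ε → a ≤ b + ε • c) :
    a ≤ b := by
  have ht : Filter.Tendsto (fun ε : ℝ ↦ b + ε • c) (nhdsWithin 0 (Set.Ioi 0)) (nhds b) := by
    have : Filter.Tendsto (fun ε : ℝ ↦ b + ε • c) (nhds 0) (nhds (b + (0 : ℝ) • c)) :=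
      Continuous.tendsto (by fun_prop) 0
    simpa using this.mono_left nhdsWithin_le_nhds
  exact ge_of_tendsto ht (Filter.eventually_of_mem self_mem_nhdsWithin h)

theorem mul_star_le_of_star_mul_le {x : A} {k : ℝ} (hk : 0 ≤ k) (h : star x * x ≤ k • (1 : A)) :
    x * star x ≤ k • (1 : A) := by
  rw [← Algebra.algebraMap_eq_smul_one] at h ⊢
  rw [← CStarAlgebra.norm_le_iff_le_algebraMap _ hk (star_mul_self_nonneg x)] at h
  rw [← CStarAlgebra.norm_le_iff_le_algebraMap _ hk (mul_star_self_nonneg x)]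
  rwa [CStarRing.norm_self_mul_star, ← CStarRing.norm_star_mul_self]

theorem star_mul_le_of_mul_star_le {x : A} {k : ℝ} (hk : 0 ≤ k) (h : x * star x ≤ k • (1 : A)) :
    star x * x ≤ k • (1 : A) := by
  simpa using mul_star_le_of_star_mul_le (x := star x) hk (by simpa using h)

theorem IsStarProjection.conj_le_conj {e a b : A} (he : IsStarProjection e) (h : a ≤ b) :
    e * a * e ≤ e * b * e := by
  simpa [he.isSelfAdjoint.star_eq] using star_left_conjugate_le_conjugate h e

theorem eq_zero_of_star_mul_self_nonpos {x : A} (h : star x * x ≤ 0) : x = 0 :=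
  CStarRing.star_mul_self_eq_zero_iff x |>.1 (le_antisymm h (star_mul_self_nonneg x))

/-- An element of the corner `f * A * f` that is bounded below by a positive multiple of `f` has an
invertible square root in that corner. -/
theorem exists_corner_sqrt {f h : A} (hf : IsStarProjection f) (hfh : f * h = h) (hhf : h * f = h)
    {δ : ℝ} (hδ : 0 < δ) (hle : δ • f ≤ h) :
    ∃ g z : A, star g = g ∧ star z = z ∧ f * g = g ∧ g * f = g ∧ f * z = z ∧ z * f = z ∧
      g * g = h ∧ z * g = f ∧ g * z = f := by
  set b : A := h + (1 - f) with hb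
  have hff := hf.isIdempotentElem.eq
  have hfb : f * b = h := by rw [hb, mul_add, mul_sub, hfh, hff]; simp
  have hbf : b * f = h := by rw [hb, add_mul, sub_mul, hhf, hff]; simp
  have hb0 : (min δ 1) • (1 : A) ≤ b := by
    calc (min δ 1) • (1 : A) = (min δ 1) • f + (min δ 1) • (1 - f) := by
          rw [← smul_add, add_sub_cancel]
      _ ≤ δ • f + (1 : ℝ) • (1 - f) := by
          gcongr
          · exact hf.nonneg
          · exact min_le_left _ _
          · exact hf.one_sub.nonneg
          · exact min_le_right _ _
      _ ≤ b := by rw [one_smul, hb]; exact add_le_add_left hle _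
  have hm : 0 < min δ 1 := lt_min hδ one_pos
  have hb1 : 0 ≤ b := le_trans (smul_nonneg hm.le zero_le_one) hb0
  have hub : IsUnit b := by
    refine CStarAlgebra.isUnit_of_le ((min δ 1) • (1 : A)) hb0 ?_
    rw [← Algebra.algebraMap_eq_smul_one]
    exact ⟨by rw [Algebra.algebraMap_eq_smul_one]; exact smul_nonneg hm.le zero_le_one,
      (hm.ne'.isUnit).map (algebraMap ℝ A)⟩
  obtain ⟨u, hu⟩ := (CFC.isUnit_sqrt_iff b).2 hub
  have hus : star (u : A) = u := by rw [hu]; exact (CFC.sqrt_nonneg b).isSelfAdjoint.star_eq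
  have huu : (u : A) * u = b := by rw [hu]; exact CFC.sqrt_mul_sqrt_self b
  have hcomm : Commute f (u : A) := by
    rw [hu]
    exact (Commute.cfcₙ_nnreal (show Commute b f by rw [Commute, SemiconjBy, hbf, hfb])
      NNReal.sqrt).symm
  have hcomm' : Commute f (↑u⁻¹ : A) := hcomm.units_inv_right
  have hus' : star (↑u⁻¹ : A) = ↑u⁻¹ := by
    have : star u = u := Units.ext hus
    rw [← Units.coe_star_inv, this]
  have hfs := hf.isSelfAdjoint.star_eq
  refine ⟨f * u, f * ↑u⁻¹, ?_, ?_, ?_, ?_, ?_, ?_, ?_, ?_, ?_⟩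
  · rw [star_mul, hus, hfs, hcomm.eq]
  · rw [star_mul, hus', hfs, hcomm'.eq]
  · rw [← mul_assoc, hff]
  · rw [mul_assoc, ← hcomm.eq, ← mul_assoc, hff]
  · rw [← mul_assoc, hff]
  · rw [mul_assoc, ← hcomm'.eq, ← mul_assoc, hff]
  · rw [mul_assoc, ← mul_assoc (u : A), ← hcomm.eq, mul_assoc, huu, ← mul_assoc, hff, hfb]
  · rw [mul_assoc, ← mul_assoc (↑u⁻¹ : A), ← hcomm'.eq, mul_assoc, Units.inv_mul, mul_one, hff]
  · rw [mul_assoc, ← mul_assoc (u : A), ← hcomm.eq, mul_assoc, Units.mul_inv, mul_one, hff]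

/-- In an AW*-algebra, a self-adjoint element not below `μ` has a nonzero spectral projection on
which it is at least `μ`. -/
theorem IsAWStar.exists_spectral_projection (hAW : IsAWStar A) {c : A} (hc : star c = c) {μ : ℝ}
    (h : ¬ c ≤ μ • (1 : A)) :
    ∃ f : A, IsStarProjection f ∧ f ≠ 0 ∧ f * c = c * f ∧ μ • f ≤ c * f := by
  have hsa : IsSelfAdjoint (c - μ • (1 : A)) := by
    rw [IsSelfAdjoint, star_sub, star_smul, star_one, hc]; simp
  set x := (c - μ • (1 : A))⁺ with hx
  set y := (c - μ • (1 : A))⁻ with hy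
  have hxy : x - y = c - μ • (1 : A) := CFC.posPart_sub_negPart _ hsa
  have hx0 : 0 ≤ x := CFC.posPart_nonneg _
  have hy0 : 0 ≤ y := CFC.negPart_nonneg _
  have hmul : x * y = 0 := CFC.posPart_mul_negPart _
  obtain ⟨f, hf, hfa, hxf⟩ := hAW.exists_support {x}
  simp only [Set.mem_singleton_iff, forall_eq] at hfa hxf
  have hfs := hf.isSelfAdjoint.star_eq
  have hfx : f * x = x := by
    simpa [hfs, hx0.isSelfAdjoint.star_eq] using congrArg star hxf
  have hfy : f * y = 0 := (hfa y).1 hmul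
  have hyf : y * f = 0 := by
    simpa [hfs, hy0.isSelfAdjoint.star_eq] using congrArg star hfy
  have hce : c = x - y + μ • (1 : A) := by rw [hxy]; abel
  have h1 : f * c = x + μ • f := by
    rw [hce, mul_add, mul_sub, hfx, hfy, mul_smul_comm, mul_one, sub_zero]
  have h2 : c * f = x + μ • f := by
    rw [hce, add_mul, sub_mul, hxf, hyf, smul_mul_assoc, one_mul, sub_zero]
  refine ⟨f, hf, ?_, h1.trans h2.symm, ?_⟩
  · rintro rfl
    apply h
    have : x = 0 := by simpa using hfx.symm
    rw [← sub_nonpos, ← hxy, this, zero_sub]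
    exact neg_nonpos.2 hy0
  · rw [h2]
    exact le_add_of_nonneg_left hx0

theorem IsStarProjection.mul_eq_of_smul_le {c e f : A} (he : IsStarProjection e)
    (hf : IsStarProjection f) (hec : e * c = c) {μ : ℝ} (hμ : 0 < μ) (h : μ • f ≤ c * f) :
    f * e = f ∧ e * f = f := by
  have h1 := he.one_sub.conj_le_conj h
  have h2 : (1 - e) * (c * f) = 0 := by rw [← mul_assoc, sub_mul, hec]; simp
  rw [h2, zero_mul, mul_smul_comm, smul_mul_assoc] at h1
  have h3 : star (f * (1 - e)) * (f * (1 - e)) = (1 - e) * f * (1 - e) := by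
    rw [star_mul, hf.isSelfAdjoint.star_eq, he.one_sub.isSelfAdjoint.star_eq, mul_assoc,
      ← mul_assoc f f, hf.isIdempotentElem.eq, mul_assoc]
  have h4 : (1 - e) * f * (1 - e) ≤ 0 := by
    have := smul_le_smul_of_nonneg_left h1 (inv_nonneg.2 hμ.le)
    rwa [smul_smul, inv_mul_cancel₀ hμ.ne', one_smul, smul_zero] at this
  have h5 : f * (1 - e) = 0 := eq_zero_of_star_mul_self_nonpos (h3 ▸ h4)
  have h6 : f * e = f := by rw [mul_sub, mul_one, sub_eq_zero] at h5; exact h5.symm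
  refine ⟨h6, ?_⟩
  simpa [he.isSelfAdjoint.star_eq, hf.isSelfAdjoint.star_eq] using congrArg star h6

end Basics

section Partition

/-- A sequence of pairwise orthogonal projections with supremum `e`, the supremum being expressed
through annihilators. -/
structure IsPartition {A : Type*} [CStarAlgebra A] (q : ℕ → A) (e : A) : Prop where
  proj : ∀ n, IsStarProjection (q n)
  ortho : ∀ i j, i ≠ j → q i * q j = 0
  proj_sup : IsStarProjection e
  sup_mul : ∀ n, e * q n = q n
  ann : ∀ a, (∀ n, q n * a = 0) → e * a = 0

/-- The partial sums of a sequence. -/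
def partialSum {A : Type*} [CStarAlgebra A] (q : ℕ → A) (n : ℕ) : A := ∑ i ∈ Finset.range n, q i

namespace IsPartition

variable {q : ℕ → A} {e : A}

omit [PartialOrder A] [StarOrderedRing A] in
theorem star_eq (h : IsPartition q e) (n : ℕ) : star (q n) = q n := (h.proj n).isSelfAdjoint.star_eq

omit [PartialOrder A] [StarOrderedRing A] in
theorem mul_self (h : IsPartition q e) (n : ℕ) : q n * q n = q n := (h.proj n).isIdempotentElem.eq

omit [PartialOrder A] [StarOrderedRing A] in
theorem star_sup (h : IsPartition q e) : star e = e := h.proj_sup.isSelfAdjoint.star_eq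

omit [PartialOrder A] [StarOrderedRing A] in
theorem sup_mul_self (h : IsPartition q e) : e * e = e := h.proj_sup.isIdempotentElem.eq

omit [PartialOrder A] [StarOrderedRing A] in
theorem mul_sup (h : IsPartition q e) (n : ℕ) : q n * e = q n := by
  simpa [h.star_eq, h.star_sup] using congrArg star (h.sup_mul n)

omit [PartialOrder A] [StarOrderedRing A] in
theorem star_partialSum (h : IsPartition q e) (n : ℕ) :
    star (partialSum q n) = partialSum q n := by
  simp [partialSum, h.star_eq]

omit [PartialOrder A] [StarOrderedRing A] in
theorem partialSum_mul_of_lt (h : IsPartition q e) {i n : ℕ} (hi : i < n) :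
    partialSum q n * q i = q i := by
  rw [partialSum, Finset.sum_mul, Finset.sum_eq_single i]
  · exact h.mul_self i
  · exact fun j _ hj ↦ h.ortho j i hj
  · exact fun hn ↦ absurd (Finset.mem_range.2 hi) hn

omit [PartialOrder A] [StarOrderedRing A] in
theorem mul_partialSum_of_lt (h : IsPartition q e) {i n : ℕ} (hi : i < n) :
    q i * partialSum q n = q i := by
  simpa [h.star_eq, h.star_partialSum] using congrArg star (h.partialSum_mul_of_lt hi)

omit [PartialOrder A] [StarOrderedRing A] in
theorem partialSum_mul_of_le (h : IsPartition q e) {i n : ℕ} (hi : n ≤ i) :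
    partialSum q n * q i = 0 := by
  rw [partialSum, Finset.sum_mul]
  refine Finset.sum_eq_zero fun j hj ↦ h.ortho j i ?_
  have := Finset.mem_range.1 hj
  omega

omit [PartialOrder A] [StarOrderedRing A] in
theorem mul_partialSum_of_le (h : IsPartition q e) {i n : ℕ} (hi : n ≤ i) :
    q i * partialSum q n = 0 := by
  simpa [h.star_eq, h.star_partialSum] using congrArg star (h.partialSum_mul_of_le hi)

omit [PartialOrder A] [StarOrderedRing A] in
theorem partialSum_mul_partialSum (h : IsPartition q e) {m n : ℕ} (hmn : m ≤ n) :
    partialSum q n * partialSum q m = partialSum q m := by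
  conv_lhs => rw [partialSum.eq_def q m, Finset.mul_sum]
  rw [partialSum]
  refine Finset.sum_congr rfl fun i hi ↦ h.partialSum_mul_of_lt ?_
  have := Finset.mem_range.1 hi
  omega

omit [PartialOrder A] [StarOrderedRing A] in
theorem partialSum_mul_partialSum' (h : IsPartition q e) {m n : ℕ} (hmn : m ≤ n) :
    partialSum q m * partialSum q n = partialSum q m := by
  simpa [h.star_partialSum] using congrArg star (h.partialSum_mul_partialSum hmn)

omit [PartialOrder A] [StarOrderedRing A] in
theorem proj_partialSum (h : IsPartition q e) (n : ℕ) : IsStarProjection (partialSum q n) :=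
  ⟨h.partialSum_mul_partialSum le_rfl, h.star_partialSum n⟩

omit [PartialOrder A] [StarOrderedRing A] in
theorem sup_mul_partialSum (h : IsPartition q e) (n : ℕ) : e * partialSum q n = partialSum q n := by
  rw [partialSum, Finset.mul_sum]
  exact Finset.sum_congr rfl fun i _ ↦ h.sup_mul i

omit [PartialOrder A] [StarOrderedRing A] in
theorem partialSum_mul_sup (h : IsPartition q e) (n : ℕ) : partialSum q n * e = partialSum q n := by
  simpa [h.star_sup, h.star_partialSum] using congrArg star (h.sup_mul_partialSum n)

end IsPartition

omit [PartialOrder A] [StarOrderedRing A] in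
theorem partialSum_succ (q : ℕ → A) (n : ℕ) : partialSum q (n + 1) = partialSum q n + q n := by
  rw [partialSum, Finset.sum_range_succ, ← partialSum]

omit [PartialOrder A] [StarOrderedRing A] in
@[simp]
theorem partialSum_zero (q : ℕ → A) : partialSum q 0 = 0 := by
  simp [partialSum]

/-- No nonzero projection under `r` is uniformly bounded away from all partial sums of `q`. -/
def NoGhost {A : Type*} [CStarAlgebra A] [PartialOrder A] (q : ℕ → A) (r : A) : Prop :=
  ∀ f : A, IsStarProjection f → r * f = f → ∀ δ : ℝ, 0 < δ →
    (∀ n, δ • f ≤ f - f * partialSum q n * f) → f = 0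

theorem star_mul_self_le_split {p c y : A} (hp : star p = p)
    (hc : c = star y * y) {α : ℝ} (hα : 0 < α) :
    c ≤ (1 + α ^ 2) • (p * c * p) + (1 + (α ^ 2)⁻¹) • ((1 - p) * c * (1 - p)) := by
  set P := 1 - p with hP
  have hPs : star P = P := by rw [hP, star_sub, star_one, hp]
  have hd : c = p * c * p + P * c * P + (p * c * P + P * c * p) := by
    rw [hP]; noncomm_ring
  have h0 := star_mul_self_nonneg (α • (y * p) - α⁻¹ • (y * P))
  have h1 : star (α • (y * p) - α⁻¹ • (y * P)) * (α • (y * p) - α⁻¹ • (y * P)) =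
      α ^ 2 • (p * c * p) + (α ^ 2)⁻¹ • (P * c * P) - (p * c * P + P * c * p) := by
    rw [hc]
    simp only [star_sub, star_smul, star_mul, hPs, hp, star_trivial, sub_mul, mul_sub,
      smul_mul_assoc, mul_smul_comm, smul_sub, smul_smul, mul_assoc, mul_inv_cancel₀ hα.ne',
      inv_mul_cancel₀ hα.ne', one_smul, ← sq, inv_pow]
    abel
  rw [h1] at h0
  have h2 := sub_nonneg.1 h0
  calc c = p * c * p + P * c * P + (p * c * P + P * c * p) := hd
    _ ≤ p * c * p + P * c * P + (α ^ 2 • (p * c * p) + (α ^ 2)⁻¹ • (P * c * P)) := by gcongr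
    _ = _ := by rw [add_smul, add_smul, one_smul, one_smul]; abel

theorem IsPartition.conj_sup_le_one {q : ℕ → A} {e : A} (hAW : IsAWStar A) (h : IsPartition q e)
    (hng : NoGhost q e) {y : A} (hy : ∀ n, y * partialSum q n * star y ≤ 1) :
    y * e * star y ≤ 1 := by
  have he := h.proj_sup
  have hes := h.star_sup
  have hee := h.sup_mul_self
  have hconv : ∀ {p : A}, star p = p → p * p = p →
      (y * p * star y ≤ 1 ↔ p * (star y * y) * p ≤ 1) := by
    intro p hp hpp
    have h1 : (y * p) * star (y * p) = y * p * star y := by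
      simp [mul_assoc, hp, mul_left_of hpp]
    have h2 : star (y * p) * (y * p) = p * (star y * y) * p := by
      simp [mul_assoc, hp]
    rw [← h1, ← h2, ← one_smul ℝ (1 : A)]
    exact ⟨star_mul_le_of_mul_star_le zero_le_one, mul_star_le_of_star_mul_le zero_le_one⟩
  rw [hconv hes hee]
  have hpy : ∀ n, partialSum q n * (star y * y) * partialSum q n ≤ 1 := fun n ↦
    (hconv (h.star_partialSum n) (h.partialSum_mul_partialSum le_rfl)).1 (hy n)
  set c := e * (star y * y) * e with hc
  have hc' : c = star (y * e) * (y * e) := by simp [hc, mul_assoc, hes]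
  have hcs : star c = c := by simp [hc, mul_assoc, hes]
  by_contra hcon
  obtain ⟨l, hl, hlc⟩ : ∃ l : ℝ, 1 < l ∧ ¬ c ≤ l • (1 : A) := by
    by_contra! hall
    refine hcon (le_of_forall_le_add_smul 1 fun ε hε ↦ ?_)
    have := hall (1 + ε) (by linarith)
    rwa [add_smul, one_smul] at this
  obtain ⟨f, hf, hf0, hcomm, hfc⟩ := hAW.exists_spectral_projection hcs hlc
  have hec : e * c = c := by simp only [hc, ← mul_assoc, hee]
  obtain ⟨hfe, hef⟩ := he.mul_eq_of_smul_le hf hec (by linarith) hfc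
  have hfs := hf.isSelfAdjoint.star_eq
  have hff := hf.isIdempotentElem.eq
  obtain ⟨M, hM0, hM⟩ : ∃ M : ℝ, 0 < M ∧ c ≤ M • (1 : A) := by
    refine ⟨‖c‖ + 1, by positivity, ?_⟩
    rw [← Algebra.algebraMap_eq_smul_one]
    exact (IsSelfAdjoint.le_algebraMap_norm_self (a := c) hcs).trans
      (algebraMap_mono A (by linarith))
  obtain ⟨b, hb, hbl⟩ : ∃ b : ℝ, 0 < b ∧ 1 + b < l := ⟨(l - 1) / 2, by linarith, by linarith⟩
  obtain ⟨α, hα, rfl⟩ : ∃ α : ℝ, 0 < α ∧ α ^ 2 = b := ⟨√b, Real.sqrt_pos.2 hb, Real.sq_sqrt hb.le⟩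
  set N : ℝ := (1 + (α ^ 2)⁻¹) * M with hN
  have hNpos : 0 < N := by positivity
  refine hf0 (hng f hf hef ((l - 1 - α ^ 2) / N) (div_pos (by linarith) hNpos) fun n ↦ ?_)
  set p := partialSum q n with hp
  have hps : star p = p := h.star_partialSum n
  have hpp : p * p = p := h.partialSum_mul_partialSum le_rfl
  have hpproj : IsStarProjection p := ⟨hpp, hps⟩
  have h1 := star_mul_self_le_split hps hc' hα
  have h2 : p * c * p ≤ p := by
    have h3 := hpproj.conj_le_conj (hpy n)
    rw [← hp, mul_one, hpp] at h3
    refine le_of_eq_of_le ?_ h3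
    have h4 : p * e = p := h.partialSum_mul_sup n
    have h5 : e * p = p := h.sup_mul_partialSum n
    simp only [hc, mul_assoc, mul_left_of hpp, hpp, mul_left_of h4, h5]
  have h3 : (1 - p) * c * (1 - p) ≤ M • (1 - p) := by
    have := hpproj.one_sub.conj_le_conj hM
    rwa [mul_smul_comm, smul_mul_assoc, mul_one, hpproj.one_sub.isIdempotentElem.eq] at this
  have h4 : c ≤ (1 + α ^ 2) • p + N • (1 - p) := by
    refine h1.trans ?_
    rw [hN, mul_smul]
    gcongr
  have h5 := hf.conj_le_conj h4
  have h6 : l • f ≤ f * c * f := by rwa [hcomm, mul_assoc, hff]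
  have h7 : l • f ≤ (1 + α ^ 2) • f + N • (f - f * p * f) := by
    refine (h6.trans h5).trans ?_
    have h8 : f * p * f ≤ f := by
      have := hf.conj_le_conj (sub_nonneg.1 hpproj.one_sub.nonneg)
      rwa [mul_one, hff] at this
    have h9 : f * ((1 + α ^ 2) • p + N • (1 - p)) * f =
        (1 + α ^ 2) • (f * p * f) + N • (f - f * p * f) := by
      simp only [mul_add, add_mul, mul_smul_comm, smul_mul_assoc, mul_sub, sub_mul, mul_one, hff]
    rw [h9]
    gcongr
  have h10 : (l - 1 - α ^ 2) • f ≤ N • (f - f * p * f) := by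
    rw [sub_sub, sub_smul]
    exact sub_le_iff_le_add'.2 h7
  rw [div_eq_inv_mul, mul_smul]
  have := smul_le_smul_of_nonneg_left h10 (inv_nonneg.2 hNpos.le)
  rwa [smul_smul N⁻¹ N, inv_mul_cancel₀ hNpos.ne', one_smul] at this

/-- A partition between whose members there are no nonzero off-diagonal elements has no ghost. -/
theorem IsPartition.noGhost_of_diagonal {q : ℕ → A} {t : A} (h : IsPartition q t)
    (hdiag : ∀ i j, i ≠ j → ∀ x, q i * x * q j = 0) : NoGhost q t := by
  intro f hf htf δ hδ hle
  have hfs := hf.isSelfAdjoint.star_eq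
  have hcomm : ∀ j, q j * f = f * q j := by
    intro j
    have h1 : t * (f * q j - q j * f * q j) = 0 := by
      refine h.ann _ fun i ↦ ?_
      by_cases hij : i = j
      · subst hij
        simp only [mul_sub, ← mul_assoc, h.mul_self, sub_self]
      · simp only [mul_sub, ← mul_assoc, hdiag i j hij, h.ortho i j hij, zero_mul, sub_zero]
    have h2 : f * q j = q j * f * q j := by
      rw [mul_sub, mul_left_of htf, ← mul_assoc, ← mul_assoc, h.sup_mul] at h1
      exact sub_eq_zero.1 h1
    have h3 := congrArg star h2
    simp only [star_mul, h.star_eq, hfs, ← mul_assoc] at h3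
    exact h3.trans h2.symm
  have hq : ∀ j, q j * f = 0 := by
    intro j
    have h1 := (h.proj j).conj_le_conj (hle (j + 1))
    have h2 : q j * (f * partialSum q (j + 1) * f) * q j = q j * f * q j := by
      have h4 := h.partialSum_mul_of_lt (Nat.lt_succ_self j)
      calc q j * (f * partialSum q (j + 1) * f) * q j
          = q j * f * partialSum q (j + 1) * (f * q j) := by simp only [mul_assoc]
        _ = q j * f * (q j * f) := by rw [← hcomm j, ← mul_assoc, mul_assoc _ _ (q j), h4, mul_assoc]
        _ = q j * f * q j := by
          nth_rw 2 [hcomm j]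
          simp only [mul_assoc, mul_left_of hf.isIdempotentElem.eq]
    rw [mul_sub, sub_mul, h2, sub_self, mul_smul_comm, smul_mul_assoc] at h1
    have h3 : star (f * q j) * (f * q j) = q j * f * q j := by
      simp only [star_mul, h.star_eq, hfs, mul_assoc, mul_left_of hf.isIdempotentElem.eq]
    have h4 : q j * f * q j ≤ 0 := by
      have := smul_le_smul_of_nonneg_left h1 (inv_nonneg.2 hδ.le)
      rwa [smul_smul, inv_mul_cancel₀ hδ.ne', one_smul, smul_zero] at this
    rw [hcomm]
    exact eq_zero_of_star_mul_self_nonpos (h3 ▸ h4)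
  rw [← htf]
  exact h.ann f hq

end Partition

section Halved

/-- Inversion in the corner of a projection `f`, with the estimate it gives for compressions. -/
theorem exists_corner_inv {f h : A} (hf : IsStarProjection f) (hfh : f * h = h) (hhf : h * f = h)
    {δ : ℝ} (hδ : 0 < δ) (hle : δ • f ≤ h) :
    ∃ k : A, star k = k ∧ f * k = k ∧ k * f = k ∧ k * h = f ∧ h * k = f ∧
      ∀ q : A, IsStarProjection q → ∀ t : ℝ, 0 ≤ t → f * q * f ≤ t • h → q * k * q ≤ t • q := by
  obtain ⟨g, z, hg, hz, hfg, hgf, hfz, hzf, hgg, hzg, hgz⟩ := exists_corner_sqrt hf hfh hhf hδ hle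
  have hff := hf.isIdempotentElem.eq
  refine ⟨z * z, by rw [star_mul, hz], ?_, ?_, ?_, ?_, fun q hq t ht hqt ↦ ?_⟩
  · rw [← mul_assoc, hfz]
  · rw [mul_assoc, hzf]
  · rw [← hgg, mul_assoc, mul_left_of hzg, hfg, hzg]
  · rw [← hgg, mul_assoc, mul_left_of hgz, hfz, hgz]
  · have hqs := hq.isSelfAdjoint.star_eq
    have hqq := hq.isIdempotentElem.eq
    have h1 : star (q * z) * (q * z) ≤ t • (1 : A) := by
      have h2 := star_left_conjugate_le_conjugate hqt z
      have h3 : star z * (f * q * f) * z = star (q * z) * (q * z) := by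
        simp only [star_mul, hz, hqs, mul_assoc, mul_left_of hzf, mul_left_of hqq, hfz]
      have h4 : star z * (t • h) * z = t • f := by
        rw [mul_smul_comm, smul_mul_assoc, hz, ← hgg, ← mul_assoc, hzg, hfg, hgz]
      rw [h3, h4] at h2
      exact h2.trans (smul_le_smul_of_nonneg_left (sub_nonneg.1 hf.one_sub.nonneg) ht)
    have h5 := hq.conj_le_conj (mul_star_le_of_star_mul_le ht h1)
    have h6 : q * (q * z * star (q * z)) * q = q * (z * z) * q := by
      simp only [star_mul, hz, hqs, mul_assoc, mul_left_of hqq, hqq]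
    rwa [h6, mul_smul_comm, smul_mul_assoc, mul_one, hqq] at h5

/-- The conditions maintained while the isometries of `exists_dilation` are extended step by
step. -/
structure IsDilation {A : Type*} [CStarAlgebra A] (σ : ℝ) (f p E V : A) : Prop where
  star_mul_self : star V * V = p
  mul_eq : V * p = V
  compress : f * V = σ • (f * p)
  range : E * V = V

omit [PartialOrder A] [StarOrderedRing A] in
/-- One step of the construction of the partial isometries in `exists_dilation`. -/
theorem IsDilation.step {σ : ℝ} {f p q E E' S z d V : A}
    (hf : IsStarProjection f) (hp : IsStarProjection p) (hq : IsStarProjection q)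
    (hE : IsStarProjection E)
    (hpq : p * q = 0) (hEf : E * f = f) (hEE : E' * E = E) (hEq : E' * q = q) (hEf' : E' * f = f)
    (hSs : star S = S) (hfS : f * S = S) (hs : (f - σ ^ 2 • (f * p * f)) * S = f)
    (hzs : star z = z) (hqz : q * z = z) (hz : z * (q * (1 - E) * q) * z = q)
    (hds : star d = d) (hdq : d * q = d)
    (hd : d * d = q - σ ^ 2 • (q * S * q)) (h : IsDilation σ f p E V) :
    ∃ V', IsDilation σ f (p + q) E' V' ∧ V' * p = V := by
  have hfs := hf.isSelfAdjoint.star_eq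
  have hff := hf.isIdempotentElem.eq
  have hps := hp.isSelfAdjoint.star_eq
  have hpp := hp.isIdempotentElem.eq
  have hqs := hq.isSelfAdjoint.star_eq
  have hqq := hq.isIdempotentElem.eq
  have hEs := hE.isSelfAdjoint.star_eq
  have hqp : q * p = 0 := by simpa [hps, hqs] using congrArg star hpq
  have hSf : S * f = S := by simpa [hfs, hSs] using congrArg star hfS
  have hfE : f * E = f := by simpa [hfs, hEs] using congrArg star hEf
  have hzq : z * q = z := by simpa [hzs, hqs] using congrArg star hqz
  obtain ⟨hVV, hVp, hfV, hEV⟩ := h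
  have hpV : p * star V = star V := by simpa [hps] using congrArg star hVp
  have hVf : star V * f = σ • (p * f) := by simpa [hps, hfs] using congrArg star hfV
  have hVE : star V * E = star V := by simpa [hEs] using congrArg star hEV
  have hSE : S * E = S := by rw [← hSf, mul_assoc, hfE]
  set a := σ • ((1 - V * star V) * (S * q)) with ha
  set b := (1 - E) * (z * d) with hb
  have hVa : star V * a = 0 := by
    rw [ha, mul_smul_comm, ← mul_assoc, mul_sub, mul_left_of hVV, hpV]
    simp
  have hVb : star V * b = 0 := by
    rw [hb, ← mul_assoc, mul_sub, hVE]
    simp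
  have haV : star a * V = 0 := by simpa using congrArg star hVa
  have hbV : star b * V = 0 := by simpa using congrArg star hVb
  have has : star a = σ • (q * S * (1 - V * star V)) := by
    rw [ha]; simp [mul_assoc, hqs, hSs]
  have hbs : star b = d * z * (1 - E) := by
    rw [hb]; simp [mul_assoc, hds, hzs, hEs]
  have hRR : (1 - V * star V) * (1 - V * star V) = 1 - V * star V := by
    have : V * star V * (V * star V) = V * star V := by
      rw [mul_assoc, mul_left_of hVV, hpV]
    rw [mul_sub, sub_mul, sub_mul, this]; simp
  have hSRS : S * (1 - V * star V) * S = S := by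
    have h1 : S * (V * star V) * S = σ ^ 2 • (S * p * S) := by
      calc S * (V * star V) * S = S * (f * V) * (star V * f) * S := by
            simp only [mul_assoc, hfS, mul_left_of hSf]
        _ = σ ^ 2 • (S * p * S) := by
            rw [hfV, hVf]
            simp only [mul_smul_comm, smul_mul_assoc, smul_smul, mul_assoc, hfS,
              mul_left_of hSf, mul_left_of hpp, ← sq]
    have h2 : S * ((f - σ ^ 2 • (f * p * f)) * S) = S * S - σ ^ 2 • (S * p * S) := by
      simp only [sub_mul, mul_sub, mul_smul_comm, smul_mul_assoc, mul_assoc, hfS,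
              mul_left_of hSf]
    rw [hs, hSf] at h2
    rw [mul_sub, sub_mul, h1, mul_one, ← h2]
  have haa : star a * a = σ ^ 2 • (q * S * q) := by
    rw [has, ha, mul_smul_comm, smul_mul_assoc, smul_smul, ← sq]
    congr 1
    calc q * S * (1 - V * star V) * ((1 - V * star V) * (S * q))
        = q * (S * ((1 - V * star V) * (1 - V * star V)) * S) * q := by simp only [mul_assoc]
      _ = _ := by rw [hRR, hSRS]
  have hab : star a * b = 0 := by
    have h1 : (1 - V * star V) * (1 - E) = 1 - E := by
      rw [sub_mul, one_mul, mul_sub, mul_assoc _ _ E, hVE]; simp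
    rw [has, hb, smul_mul_assoc, mul_assoc (q * S), ← mul_assoc (1 - V * star V), h1,
      ← mul_assoc, mul_assoc q, mul_sub, hSE]
    simp
  have hba : star b * a = 0 := by simpa using congrArg star hab
  have hbb : star b * b = q - σ ^ 2 • (q * S * q) := by
    rw [hbs, hb, ← hd]
    calc d * z * (1 - E) * ((1 - E) * (z * d))
        = d * (z * ((1 - E) * (1 - E)) * z) * d := by simp only [mul_assoc]
      _ = d * (z * (q * (1 - E) * q) * z) * d := by
        rw [hE.one_sub.isIdempotentElem.eq]
        simp only [mul_assoc, hqz, mul_left_of hzq]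
      _ = d * d := by rw [hz, hdq]
  have haq : a * q = a := by
    rw [ha, smul_mul_assoc]; simp only [mul_assoc, hqq]
  have hbq : b * q = b := by
    rw [hb]; simp only [mul_assoc, hdq]
  have hap : a * p = 0 := by rw [← haq, mul_assoc, hqp, mul_zero]
  have hbp : b * p = 0 := by rw [← hbq, mul_assoc, hqp, mul_zero]
  have hVq : V * q = 0 := by rw [← hVp, mul_assoc, hpq, mul_zero]
  have hfa : f * a = σ • (f * q) := by
    have h1 : f * (1 - V * star V) * S = f := by
      calc f * (1 - V * star V) * S = f * (f * S) - f * V * (star V * f) * S := by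
            simp only [mul_sub, sub_mul, mul_assoc, hfS, mul_one]
        _ = (f - σ ^ 2 • (f * p * f)) * S := by
            rw [hfV, hVf]
            simp only [mul_smul_comm, smul_mul_assoc, smul_smul, mul_assoc, hfS,
              mul_left_of hpp, ← sq, sub_mul]
        _ = f := hs
    rw [ha, mul_smul_comm, ← mul_assoc, ← mul_assoc, h1]
  have hfb : f * b = 0 := by
    rw [hb, ← mul_assoc, mul_sub, hfE]; simp
  have hEV' : E' * V = V := by rw [← hEV, mul_left_of hEE]
  have hES' : E' * S = S := by rw [← hfS, mul_left_of hEf']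
  have hEz' : E' * z = z := by rw [← hqz, mul_left_of hEq]
  have hEa : E' * a = a := by
    rw [ha, mul_smul_comm, sub_mul, mul_sub, one_mul, mul_left_of hES']
    simp only [mul_assoc, mul_left_of hEV']
  have hEb : E' * b = b := by
    rw [hb, sub_mul, mul_sub, one_mul, mul_left_of hEz', mul_left_of hEE]
  refine ⟨V + (a + b), ⟨?_, ?_, ?_, ?_⟩, ?_⟩
  · simp only [star_add, add_mul, mul_add, hVV, hVa, hVb, haV, hbV, haa, hab, hba, hbb]
    simp
  · simp only [add_mul, mul_add, hVp, hap, hbp, hVq, haq, hbq]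
    simp
  · simp only [mul_add, hfV, hfa, hfb, smul_add, add_zero]
  · simp only [mul_add, hEV', hEa, hEb]
  · simp only [add_mul, hVp, hap, hbp, add_zero]

theorem IsPartition.exists_dilation {q : ℕ → A} {r f : A} (h : IsPartition q r)
    (hf : IsStarProjection f) (hrf : r * f = f) {δ : ℝ} (hδ : 0 < δ)
    (hle : ∀ n, δ • f ≤ f - f * partialSum q n * f) :
    ∃ σ : ℝ, 1 < σ ∧ ∃ w : ℕ → A, (∀ j, w j * q j = w j) ∧ (∀ j, star (w j) * w j = q j) ∧
      (∀ i j, i ≠ j → star (w i) * w j = 0) ∧ (∀ j, r * w j = w j) ∧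
      ∀ j, f * w j = σ • (f * q j) := by
  wlog hδ1 : δ ≤ 1 generalizing δ
  · refine this (δ := 1) one_pos (fun n ↦ le_trans ?_ (hle n)) le_rfl
    exact smul_le_smul_of_nonneg_right (not_le.1 hδ1).le hf.nonneg
  have hfs := hf.isSelfAdjoint.star_eq
  have hff := hf.isIdempotentElem.eq
  set p := partialSum q with hp
  have hpproj : ∀ n, IsStarProjection (p n) := h.proj_partialSum
  have hps : ∀ n, star (p n) = p n := h.star_partialSum
  have hpp : ∀ n, p n * p n = p n := fun n ↦ (hpproj n).isIdempotentElem.eq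
  obtain ⟨σ, hσ1, hσ⟩ : ∃ σ : ℝ, 1 < σ ∧ σ ^ 2 = 1 + δ / 2 :=
    ⟨√(1 + δ / 2), by rw [Real.lt_sqrt] <;> linarith, Real.sq_sqrt (by linarith)⟩
  have hfpf : ∀ n, 0 ≤ f * p n * f := fun n ↦ by
    simpa [hfs] using star_left_conjugate_nonneg (hpproj n).nonneg f
  have hsum : ∀ n, f * p (n + 1) * f = f * p n * f + f * q n * f := fun n ↦ by
    rw [hp, partialSum_succ, mul_add, add_mul]
  -- the defect of the partial sums, and the same for the scaled partial sums
  set s : ℕ → A := fun n ↦ f - σ ^ 2 • (f * p n * f) with hs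
  have hsle : ∀ n, (δ / 2) • f ≤ s n := by
    intro n
    have h1 := smul_le_smul_of_nonneg_left (hle n) (sq_nonneg σ)
    have h2 : s n = σ ^ 2 • (f - f * p n * f) - (δ / 2) • f := by
      simp only [hs, smul_sub, hσ, add_smul, one_smul]; abel
    rw [h2, le_sub_iff_add_le, ← add_smul]
    refine le_trans ?_ h1
    rw [smul_smul]
    exact smul_le_smul_of_nonneg_right (by rw [hσ]; nlinarith) hf.nonneg
  have hinvH : ∀ n, ∃ k : A, star k = k ∧ f * k = k ∧ k * f = k ∧ k * (f - f * p n * f) = f ∧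
      (f - f * p n * f) * k = f ∧ ∀ q : A, IsStarProjection q → ∀ t : ℝ, 0 ≤ t →
      f * q * f ≤ t • (f - f * p n * f) → q * k * q ≤ t • q := fun n ↦
    exists_corner_inv hf (by simp only [mul_sub, ← mul_assoc, hff])
      (by simp only [sub_mul, mul_assoc, hff]) hδ (hle n)
  have hinvS : ∀ n, ∃ k : A, star k = k ∧ f * k = k ∧ k * f = k ∧ k * s n = f ∧
      s n * k = f ∧ ∀ q : A, IsStarProjection q → ∀ t : ℝ, 0 ≤ t →
      f * q * f ≤ t • s n → q * k * q ≤ t • q := fun n ↦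
    exists_corner_inv hf (by simp only [hs, mul_sub, mul_smul_comm, ← mul_assoc, hff])
      (by simp only [hs, sub_mul, smul_mul_assoc, mul_assoc, hff]) (half_pos hδ) (hsle n)
  choose H hHs hfH hHf hHh _ hHq using hinvH
  choose S hSs hfS hSf _ hsS hSq using hinvS
  set E : ℕ → A := fun n ↦ p n + (1 - p n) * H n * (1 - p n) with hE
  have hPp : ∀ m n, m ≤ n → (1 - p n) * p m = 0 := fun m n hmn ↦ by
    rw [sub_mul, one_mul, h.partialSum_mul_partialSum hmn, sub_self]
  have hEf : ∀ n, E n * f = f := fun n ↦ by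
    have h1 : (1 - p n) * H n * (1 - p n) * f = (1 - p n) * f := by
      calc (1 - p n) * H n * (1 - p n) * f = (1 - p n) * (H n * f * (1 - p n) * f) := by
            simp only [mul_assoc, mul_left_of (hHf n)]
        _ = (1 - p n) * (H n * (f - f * p n * f)) := by
            simp only [mul_sub, sub_mul, mul_assoc, mul_left_of (hHf n), mul_one, hff]
        _ = (1 - p n) * f := by rw [hHh]
    change (p n + _) * f = f
    rw [add_mul, h1, sub_mul, one_mul]
    abel
  have hEp : ∀ m n, m ≤ n → E n * p m = p m := fun m n hmn ↦ by
    change (p n + _) * p m = p m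
    rw [add_mul, mul_assoc, hPp m n hmn, mul_zero, add_zero]
    exact h.partialSum_mul_partialSum hmn
  have hEE : ∀ m n, m ≤ n → E n * E m = E m := fun m n hmn ↦ by
    have h0 : E n * ((1 - p m) * f) = (1 - p m) * f := by
      rw [sub_mul, mul_sub, one_mul, hEf, mul_left_of (hEp m n hmn)]
    have h1 : E n * ((1 - p m) * H m * (1 - p m)) = (1 - p m) * H m * (1 - p m) := by
      calc E n * ((1 - p m) * H m * (1 - p m))
          = E n * ((1 - p m) * f) * (H m * (1 - p m)) := by
            simp only [mul_assoc, mul_left_of (hfH m)]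
        _ = (1 - p m) * H m * (1 - p m) := by
            rw [h0]
            simp only [mul_assoc, mul_left_of (hfH m)]
    change E n * (p m + _) = p m + _
    rw [mul_add, hEp m n hmn, h1]
  have hEs : ∀ n, star (E n) = E n := fun n ↦ by
    simp [hE, hps, hHs, mul_assoc]
  have hEproj : ∀ n, IsStarProjection (E n) := fun n ↦ ⟨hEE n n le_rfl, hEs n⟩
  have hrE : ∀ n, r * E n = E n := fun n ↦ by
    have h1 : r * p n = p n := h.sup_mul_partialSum n
    have h2 : r * H n = H n := by rw [← hfH n, mul_left_of hrf]
    simp only [hE, sub_mul, mul_sub, mul_add, one_mul, h1, h2, mul_left_of h1, mul_assoc,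
      mul_left_of h2, mul_one]
  have hEq : ∀ n, E (n + 1) * q n = q n := fun n ↦ by
    have h1 : p (n + 1) * q n = q n := h.partialSum_mul_of_lt (Nat.lt_succ_self n)
    rw [← h1, mul_left_of (hEp _ _ le_rfl)]
  have hexz : ∀ n, ∃ z : A, star z = z ∧ q n * z = z ∧ z * (q n * (1 - E n) * q n) * z = q n := by
    intro n
    have hpq : p n * q n = 0 := h.partialSum_mul_of_le le_rfl
    have hqp : q n * p n = 0 := h.mul_partialSum_of_le le_rfl
    have h1 : q n * (1 - E n) * q n = q n - q n * H n * q n := by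
      simp only [hE, mul_sub, sub_mul, mul_add, add_mul, mul_one, one_mul, mul_assoc, hpq,
        mul_left_of hqp, h.mul_self, zero_mul, mul_zero]
      simp
    have h2 : q n * H n * q n ≤ (1 - δ) • q n := by
      refine hHq n _ (h.proj n) _ (by linarith) ?_
      have h3 : f * q n * f = (f - f * p n * f) - (f - f * p (n + 1) * f) := by
        rw [hsum]; abel
      have h4 : δ • (f - f * p n * f) ≤ f - f * p (n + 1) * f := by
        refine le_trans (smul_le_smul_of_nonneg_left ?_ hδ.le) (hle (n + 1))
        exact sub_le_self _ (hfpf n)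
      rw [h3, sub_smul, one_smul]
      exact sub_le_sub_left h4 _
    obtain ⟨g, z, hg, hz, hqg, hgq, hqz, hzq, hgg, hzg, hgz⟩ :=
      exists_corner_sqrt (h.proj n) (h := q n * (1 - E n) * q n) (δ := δ)
        (by simp only [← mul_assoc, h.mul_self]) (by simp only [mul_assoc, h.mul_self]) hδ
        (by rw [h1, le_sub_comm]; convert h2 using 1; rw [sub_smul, one_smul])
    refine ⟨z, hz, hqz, ?_⟩
    rw [← hgg, ← mul_assoc, hzg, hqg, hgz]
  have hexd : ∀ n, ∃ d : A, star d = d ∧ d * q n = d ∧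
      d * d = q n - σ ^ 2 • (q n * S n * q n) := by
    intro n
    have h2 : σ ^ 2 • (q n * S n * q n) ≤ (1 - δ / 2) • q n := by
      have hσ0 : (0 : ℝ) < σ ^ 2 := by positivity
      have h5 : q n * S n * q n ≤ ((σ ^ 2)⁻¹ * (1 - δ / 2)) • q n := by
        refine hSq n _ (h.proj n) _ (mul_nonneg (by positivity) (by linarith)) ?_
        have h3 : σ ^ 2 • (f * q n * f) = s n - s (n + 1) := by
          simp only [hs, hsum, smul_add]; abel
        have h4 : (δ / 2) • s n ≤ s (n + 1) := by
          refine le_trans (smul_le_smul_of_nonneg_left ?_ (by linarith)) (hsle (n + 1))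
          exact sub_le_self _ (smul_nonneg hσ0.le (hfpf n))
        have h6 : σ ^ 2 • (f * q n * f) ≤ (1 - δ / 2) • s n := by
          rw [h3, sub_smul, one_smul]
          exact sub_le_sub_left h4 _
        have h7 := smul_le_smul_of_nonneg_left h6 (inv_nonneg.2 hσ0.le)
        rwa [smul_smul, inv_mul_cancel₀ hσ0.ne', one_smul, smul_smul] at h7
      have h7 := smul_le_smul_of_nonneg_left h5 hσ0.le
      rwa [smul_smul, mul_inv_cancel_left₀ hσ0.ne'] at h7
    obtain ⟨g, z, hg, hz, hqg, hgq, -, -, hgg, -, -⟩ :=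
      exists_corner_sqrt (h.proj n) (h := q n - σ ^ 2 • (q n * S n * q n)) (δ := δ / 2)
        (by simp only [mul_sub, mul_smul_comm, ← mul_assoc, h.mul_self])
        (by simp only [sub_mul, smul_mul_assoc, mul_assoc, h.mul_self]) (half_pos hδ)
        (by rw [le_sub_comm]; convert h2 using 1; rw [sub_smul, one_smul])
    exact ⟨g, hg, hgq, hgg⟩
  have hstep : ∀ n V, IsDilation σ f (p n) (E n) V →
      ∃ V', IsDilation σ f (p (n + 1)) (E (n + 1)) V' ∧ V' * p n = V := by
    intro n V hV
    obtain ⟨z, hzs, hqz, hz⟩ := hexz n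
    obtain ⟨d, hds, hdq, hd⟩ := hexd n
    rw [show p (n + 1) = p n + q n from partialSum_succ q n]
    exact hV.step hf (hpproj n) (h.proj n) (hEproj n) (h.partialSum_mul_of_le le_rfl) (hEf n)
      (hEE n _ n.le_succ) (hEq n) (hEf _) (hSs n) (hfS n) (hsS n) hzs hqz hz hds hdq hd
  choose! next hnext hnextp using hstep
  set V : ℕ → A := fun n ↦ Nat.rec 0 next n with hVdef
  have hV : ∀ n, IsDilation σ f (p n) (E n) (V n) := by
    intro n
    induction n with
    | zero => exact ⟨by simp [hVdef, hp], by simp [hVdef], by simp [hVdef, hp], by simp [hVdef]⟩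
    | succ n ih => exact hnext n _ ih
  have hVsucc : ∀ n, V (n + 1) * p n = V n := fun n ↦ hnextp n _ (hV n)
  have hVq : ∀ m n, m < n → V n * q m = V (m + 1) * q m := by
    intro m n hmn
    induction n, hmn using Nat.le_induction with
    | base => rfl
    | succ n hmn ih =>
      rw [← ih, ← hVsucc n, mul_assoc, h.partialSum_mul_of_lt hmn]
  have hww : ∀ i j, star (V (i + 1) * q i) * (V (j + 1) * q j) = q i * q j := by
    intro i j
    rw [← hVq i (max i j + 1) (by omega), ← hVq j (max i j + 1) (by omega), star_mul,
      h.star_eq, mul_assoc, mul_left_of (hV (max i j + 1)).star_mul_self, h.partialSum_mul_of_lt (by omega)]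
  refine ⟨σ, hσ1, fun n ↦ V (n + 1) * q n, fun j ↦ ?_, fun j ↦ ?_, fun i j hij ↦ ?_, fun j ↦ ?_,
    fun j ↦ ?_⟩
  · rw [mul_assoc, h.mul_self]
  · rw [hww, h.mul_self]
  · rw [hww, h.ortho i j hij]
  · change r * (V (j + 1) * q j) = V (j + 1) * q j
    have h1 : r * V (j + 1) = V (j + 1) := by
      rw [← (hV (j + 1)).range, mul_left_of (hrE _)]
    rw [← mul_assoc, h1]
  · rw [← mul_assoc, (hV (j + 1)).compress, smul_mul_assoc, mul_assoc,
      h.partialSum_mul_of_lt j.lt_succ_self]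

/-- A partition of a projection that is the initial projection of a partial isometry with
orthogonal range has no ghost. -/
theorem IsPartition.noGhost_of_halving {q : ℕ → A} {r U : A} (hAW : IsAWStar A)
    (h : IsPartition q r) (hUU : star U * U = r) (hUr : U * r = U) (hrU : r * U = 0) :
    NoGhost q r := by
  intro f hf hrf δ hδ hle
  obtain ⟨σ, hσ, w, -, hww, hww', hrw, hfw⟩ := h.exists_dilation hf hrf hδ hle
  have hfs := hf.isSelfAdjoint.star_eq
  have hff := hf.isIdempotentElem.eq
  have hUsr : star U * r = 0 := by simpa [h.star_sup] using congrArg star hrU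
  have hUw : ∀ j, star U * w j = 0 := fun j ↦ by rw [← hrw j, mul_left_of hUsr, zero_mul]
  have hwU : ∀ j, star (w j) * U = 0 := fun j ↦ by simpa using congrArg star (hUw j)
  obtain ⟨R, hR, hRa, hRS⟩ := hAW.exists_support (Set.range fun j ↦ star (w j + U * q j))
  simp only [Set.forall_mem_range] at hRa hRS
  have hRs := hR.isSelfAdjoint.star_eq
  have hRx : ∀ j, R * (w j + U * q j) = w j + U * q j := fun j ↦ by
    simpa [hRs] using congrArg star (hRS j)
  have hRx' : ∀ j, R * (w j - U * q j) = 0 := fun j ↦ by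
    refine (hRa _).1 fun i ↦ ?_
    simp only [star_add, star_mul, h.star_eq, add_mul, mul_sub, mul_left_of (hwU i), mul_assoc,
      hUw, mul_left_of hUU, h.sup_mul, zero_mul, mul_zero]
    by_cases hij : i = j
    · subst hij
      simp [hww, h.mul_self]
    · simp [hww' i j hij, h.ortho i j hij]
  set J := R + R - 1 with hJ
  have hJs : star J = J := by simp [hJ, hRs]
  have hJJ : J * J = 1 := by
    have : J * J = 1 + 4 • (R * R - R) := by rw [hJ]; noncomm_ring
    rw [this, hR.isIdempotentElem.eq]; simp
  have hJU : ∀ j, J * (U * q j) = w j := fun j ↦ by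
    have h1 : J * (U * q j) = R * (w j + U * q j) - R * (w j - U * q j) - U * q j := by
      rw [hJ]; noncomm_ring
    rw [h1, hRx, hRx']; abel
  have hK : f * J * U = σ • f := by
    have h1 : r * star (f * J * U - σ • f) = 0 := by
      refine h.ann _ fun j ↦ ?_
      have h2 : (f * J * U - σ • f) * q j = 0 := by
        rw [sub_mul, mul_assoc, mul_assoc, hJU, hfw, smul_mul_assoc, sub_self]
      simpa [h.star_eq] using congrArg star h2
    have h2 : (f * J * U - σ • f) * r = 0 := by simpa [h.star_sup] using congrArg star h1
    have hfr : f * r = f := by simpa [h.star_sup, hfs] using congrArg star hrf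
    rw [sub_mul, mul_assoc _ U, hUr, smul_mul_assoc, hfr] at h2
    exact sub_eq_zero.1 h2
  have hUU1 : U * star U ≤ 1 := by
    have := mul_star_le_of_star_mul_le (x := U) zero_le_one
      (by rw [hUU, one_smul]; exact sub_nonneg.1 h.proj_sup.one_sub.nonneg)
    rwa [one_smul] at this
  have h1 := star_right_conjugate_le_conjugate hUU1 (f * J)
  have h2 : f * J * (U * star U) * star (f * J) = σ ^ 2 • f := by
    calc f * J * (U * star U) * star (f * J) = (f * J * U) * star (f * J * U) := by
          simp [mul_assoc]
      _ = σ ^ 2 • f := by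
          rw [hK, star_smul, hfs, star_trivial, smul_mul_smul_comm, hff, sq]
  have h3 : f * J * 1 * star (f * J) = f := by
    rw [mul_one, star_mul, hJs, mul_assoc, mul_left_of hJJ, one_mul, hfs, hff]
  rw [h2, h3] at h1
  have h4 : (σ ^ 2 - 1) • f ≤ 0 := by
    rw [sub_smul, one_smul]
    exact sub_nonpos.2 h1
  have h5 : 0 < σ ^ 2 - 1 := by nlinarith
  have h6 := smul_le_smul_of_nonneg_left h4 (inv_nonneg.2 h5.le)
  rw [smul_smul, inv_mul_cancel₀ h5.ne', one_smul, smul_zero] at h6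
  exact le_antisymm h6 hf.nonneg

end Halved

section OffDiagonal

omit [PartialOrder A] [StarOrderedRing A] in
/-- The right support of a family of partial isometries that are mutually orthogonal and have
products zero is the initial projection of a partial isometry with orthogonal range. -/
theorem exists_halving (hAW : IsAWStar A) {𝓤 : Set A} (hiso : ∀ u ∈ 𝓤, u * star u * u = u)
    (hright : ∀ u ∈ 𝓤, ∀ v ∈ 𝓤, u ≠ v → u * star v = 0)
    (hleft : ∀ u ∈ 𝓤, ∀ v ∈ 𝓤, u ≠ v → star u * v = 0) (hmul : ∀ u ∈ 𝓤, ∀ v ∈ 𝓤, u * v = 0)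
    {r : A} (hr : IsStarProjection r) (hra : ∀ a, (∀ u ∈ 𝓤, u * a = 0) → r * a = 0) :
    ∃ U : A, star U * U = r ∧ U * r = U ∧ r * U = 0 := by
  obtain ⟨R, hR, hRa, hRS⟩ := hAW.exists_support ((fun u ↦ star (u + star u * u)) '' 𝓤)
  simp only [Set.forall_mem_image] at hRa hRS
  have hRs := hR.isSelfAdjoint.star_eq
  have hrs := hr.isSelfAdjoint.star_eq
  have hrr := hr.isIdempotentElem.eq
  have hRx : ∀ u ∈ 𝓤, R * (u + star u * u) = u + star u * u := fun u hu ↦ by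
    simpa [hRs] using congrArg star (hRS hu)
  have hss : ∀ u ∈ 𝓤, ∀ v ∈ 𝓤, star u * star v = 0 := fun u hu v hv ↦ by
    rw [← star_mul, hmul v hv u hu, star_zero]
  have hRx' : ∀ u ∈ 𝓤, R * (u - star u * u) = 0 := fun v hv ↦ by
    refine (hRa _).1 fun u hu ↦ ?_
    simp only [star_add, star_mul, star_star, add_mul, mul_sub, mul_assoc, hmul u hu v hv,
      mul_left_of (hss u hu v hv), mul_zero, zero_mul]
    by_cases huv : u = v
    · subst huv
      rw [← mul_assoc u, hiso u hu]; simp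
    · simp [hleft u hu v hv huv, mul_left_of (hright u hu v hv huv)]
  set J := R + R - 1 with hJ
  have hJs : star J = J := by simp [hJ, hRs]
  have hJJ : J * J = 1 := by
    have : J * J = 1 + 4 • (R * R - R) := by rw [hJ]; noncomm_ring
    rw [this, hR.isIdempotentElem.eq]; simp
  have hJu : ∀ u ∈ 𝓤, J * (star u * u) = u := fun u hu ↦ by
    have h1 : J * (star u * u) =
        R * (u + star u * u) - R * (u - star u * u) - star u * u := by
      rw [hJ]; noncomm_ring
    rw [h1, hRx u hu, hRx' u hu]; abel
  have hJs' : ∀ u ∈ 𝓤, J * star u = u * star u := fun u hu ↦ by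
    have h1 : star u * u * star u = star u := by
      simpa [mul_assoc] using congrArg star (hiso u hu)
    conv_lhs => rw [← h1]
    rw [← mul_assoc, hJu u hu]
  refine ⟨J * r, ?_, by rw [mul_assoc, hrr], hra _ fun u hu ↦ ?_⟩
  · rw [star_mul, hJs, hrs, mul_assoc, mul_left_of hJJ, one_mul, hrr]
  · have h1 : r * (J * star u) = 0 := hra _ fun v hv ↦ by
      rw [hJs' u hu, mul_left_of (hmul v hv u hu), zero_mul]
    simpa [mul_assoc, hJs, hrs] using congrArg star h1

/-- Families of mutually orthogonal partial isometries, each with initial and final projection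
below different members of the sequence `q`, and with all products zero. -/
structure IsOffDiagonal {A : Type*} [CStarAlgebra A] (q : ℕ → A) (𝓤 : Set A) : Prop where
  iso : ∀ u ∈ 𝓤, u * star u * u = u
  right : ∀ u ∈ 𝓤, ∀ v ∈ 𝓤, u ≠ v → u * star v = 0
  left : ∀ u ∈ 𝓤, ∀ v ∈ 𝓤, u ≠ v → star u * v = 0
  mul : ∀ u ∈ 𝓤, ∀ v ∈ 𝓤, u * v = 0
  supp : ∀ u ∈ 𝓤, ∃ i j, i ≠ j ∧ q i * u = u ∧ u * q j = u

omit [PartialOrder A] [StarOrderedRing A] in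
theorem exists_maximal_isOffDiagonal (q : ℕ → A) : ∃ 𝓤, Maximal (IsOffDiagonal q) 𝓤 := by
  refine zorn_subset {𝓤 | IsOffDiagonal q 𝓤} fun c hc hchain ↦ ?_
  have hpair : ∀ u ∈ ⋃₀ c, ∀ v ∈ ⋃₀ c, ∃ 𝓤, IsOffDiagonal q 𝓤 ∧ u ∈ 𝓤 ∧ v ∈ 𝓤 := by
    rintro u ⟨𝓤, h𝓤, hu⟩ v ⟨𝓥, h𝓥, hv⟩
    rcases hchain.total h𝓤 h𝓥 with h | h
    · exact ⟨𝓥, hc h𝓥, h hu, hv⟩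
    · exact ⟨𝓤, hc h𝓤, hu, h hv⟩
  refine ⟨⋃₀ c, ⟨fun u hu ↦ ?_, fun u hu v hv ↦ ?_, fun u hu v hv ↦ ?_, fun u hu v hv ↦ ?_,
    fun u hu ↦ ?_⟩, fun s hs ↦ Set.subset_sUnion_of_mem hs⟩
  · obtain ⟨𝓤, h, hu, -⟩ := hpair u hu u hu
    exact h.iso u hu
  · obtain ⟨𝓤, h, hu, hv⟩ := hpair u hu v hv
    exact h.right u hu v hv
  · obtain ⟨𝓤, h, hu, hv⟩ := hpair u hu v hv
    exact h.left u hu v hv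
  · obtain ⟨𝓤, h, hu, hv⟩ := hpair u hu v hv
    exact h.mul u hu v hv
  · obtain ⟨𝓤, h, hu, -⟩ := hpair u hu u hu
    exact h.supp u hu

omit [PartialOrder A] [StarOrderedRing A] in
theorem IsStarProjection.commute_of_support {r a : A} {S : Set A} (hr : IsStarProjection r)
    (hra : ∀ b, (∀ u ∈ S, u * b = 0) → r * b = 0) (hS : ∀ u ∈ S, u * r = u) (ha : star a = a)
    (h : ∀ u ∈ S, u * a = u ∨ u * a = 0) : r * a = a * r := by
  have h1 : r * (a * (1 - r)) = 0 := hra _ fun u hu ↦ by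
    rcases h u hu with h | h
    · rw [mul_left_of h, mul_sub, hS u hu, mul_one, sub_self]
    · rw [mul_left_of h, zero_mul]
  have h2 : r * a = r * a * r := by
    rw [mul_sub, mul_one, mul_sub, sub_eq_zero] at h1
    exact h1.trans (mul_assoc r a r).symm
  have h3 : a * r = r * a * r := by
    simpa [ha, hr.isSelfAdjoint.star_eq, mul_assoc] using congrArg star h2
  rw [h2, ← h3]

omit [PartialOrder A] [StarOrderedRing A] in
theorem partialSum_mul_right (q : ℕ → A) (r : A) (n : ℕ) :
    partialSum (fun n ↦ q n * r) n = partialSum q n * r := by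
  rw [partialSum, partialSum, Finset.sum_mul]

namespace IsPartition

variable {q : ℕ → A} {e r : A}

omit [PartialOrder A] [StarOrderedRing A] in
theorem mul_right (h : IsPartition q e) (hr : IsStarProjection r) (her : e * r = r)
    (hcomm : ∀ n, r * q n = q n * r) : IsPartition (fun n ↦ q n * r) r where
  proj n := ⟨by
    change q n * r * (q n * r) = q n * r
    rw [mul_assoc, mul_left_of (hcomm n), mul_assoc, hr.isIdempotentElem.eq,
      mul_left_of (h.mul_self n)], by
    change star (q n * r) = q n * r
    rw [star_mul, hr.isSelfAdjoint.star_eq, h.star_eq, hcomm]⟩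
  ortho i j hij := by
    rw [mul_assoc, mul_left_of (hcomm j), mul_assoc, mul_left_of (h.ortho i j hij), zero_mul]
  proj_sup := hr
  sup_mul n := by rw [mul_left_of (hcomm n), mul_assoc, hr.isIdempotentElem.eq]
  ann a ha := by
    rw [← her, mul_assoc]
    exact h.ann _ fun n ↦ by rw [← mul_assoc, ha]

theorem conj_le_one_of_commute (hAW : IsAWStar A) (h : IsPartition q e) (hr : IsStarProjection r)
    (her : e * r = r) (hcomm : ∀ n, r * q n = q n * r) (hng : NoGhost (fun n ↦ q n * r) r) {y : A}
    (hy : ∀ n, y * partialSum q n * star y ≤ 1) : y * r * star y ≤ 1 := by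
  refine (h.mul_right hr her hcomm).conj_sup_le_one hAW hng fun n ↦ le_trans ?_ (hy n)
  refine star_right_conjugate_le_conjugate ?_ y
  rw [partialSum_mul_right]
  have hc : r * partialSum q n = partialSum q n * r := by
    rw [partialSum, Finset.mul_sum, Finset.sum_mul]
    exact Finset.sum_congr rfl fun i _ ↦ hcomm i
  have hp := h.proj_partialSum n
  have h1 := hp.conj_le_conj (sub_nonneg.1 hr.one_sub.nonneg)
  rwa [mul_one, mul_assoc, hc, mul_left_of hp.isIdempotentElem.eq, hp.isIdempotentElem.eq] at h1

theorem offDiagonal_eq_zero (hAW : IsAWStar A) (h : IsPartition q e) {𝓤 : Set A}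
    (hmax : Maximal (IsOffDiagonal q) 𝓤) {r s t : A}
    (hUr : ∀ u ∈ 𝓤, u * r = u) (hsU : ∀ u ∈ 𝓤, s * u = u) (hr : star r = r) (hs : star s = s)
    (ht : IsStarProjection t) (htr : t * r = 0) (hts : t * s = 0)
    (hcomm : ∀ n, t * q n = q n * t) {i j : ℕ} (hij : i ≠ j) (x : A) :
    q i * t * x * (q j * t) = 0 := by
  have htS := ht.isSelfAdjoint.star_eq
  have htt := ht.isIdempotentElem.eq
  have hrt : r * t = 0 := by simpa [hr, htS] using congrArg star htr
  have hst : s * t = 0 := by simpa [hs, htS] using congrArg star hts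
  by_contra hx
  set y := q i * t * x * (q j * t) with hy
  have hqy : q i * y = y := by simp only [hy, ← mul_assoc, h.mul_self]
  have hty : t * y = y := by simp only [hy, ← mul_assoc, hcomm, mul_assoc (q i) t t, htt]
  have hyq : y * q j = y := by
    rw [hy, mul_assoc _ _ (q j), mul_assoc (q j), hcomm, mul_left_of (h.mul_self j)]
  have hyt : y * t = y := by simp only [hy, mul_assoc, htt]
  set c := star y * y with hc
  have hcs : star c = c := by simp [hc]
  obtain ⟨μ, hμ, hcμ⟩ : ∃ μ : ℝ, 0 < μ ∧ ¬ c ≤ μ • (1 : A) := by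
    by_contra! hall
    refine hx (eq_zero_of_star_mul_self_nonpos (le_of_forall_le_add_smul 1 fun ε hε ↦ ?_))
    rw [zero_add]
    exact hall ε hε
  obtain ⟨f, hf, hf0, hfc, hle⟩ := hAW.exists_spectral_projection hcs hcμ
  have hff := hf.isIdempotentElem.eq
  obtain ⟨g, z, hg, hz, hfg, hgf, hfz, hzf, hgg, hzg, hgz⟩ := exists_corner_sqrt hf (h := c * f)
    (by rw [mul_left_of hfc, mul_assoc, hff]) (by rw [mul_assoc, hff]) hμ hle
  have hqc : q j * c = c := by
    rw [hc, ← mul_assoc]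
    congr 1
    simpa [h.star_eq] using congrArg star hyq
  have htc : t * c = c := by
    rw [hc, ← mul_assoc]
    congr 1
    simpa [htS] using congrArg star hyt
  obtain ⟨hfq, hqf⟩ := (h.proj j).mul_eq_of_smul_le hf hqc hμ hle
  obtain ⟨hft, htf⟩ := ht.mul_eq_of_smul_le hf htc hμ hle
  set u := y * z with hu
  have huu : star u * u = f := by
    calc star u * u = z * (c * f) * z := by
          simp only [hu, hc, star_mul, hz, mul_assoc, hfz]
      _ = f := by rw [← hgg, ← mul_assoc, hzg, hfg, hgz]
  have huf : u * f = u := by rw [hu, mul_assoc, hzf]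
  have hqu : q i * u = u := by rw [hu, mul_left_of hqy]
  have htu : t * u = u := by rw [hu, mul_left_of hty]
  have huq : u * q j = u := by rw [← huf, mul_assoc, hfq]
  have hut : u * t = u := by rw [← huf, mul_assoc, hft]
  have hur : u * r = 0 := by rw [← hut, mul_assoc, htr, mul_zero]
  have hus : u * s = 0 := by rw [← hut, mul_assoc, hts, mul_zero]
  have hru : r * u = 0 := by rw [← htu, mul_left_of hrt, zero_mul]
  have hsu : s * u = 0 := by rw [← htu, mul_left_of hst, zero_mul]
  have huv : ∀ v ∈ 𝓤, u * star v = 0 := fun v hv ↦ by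
    have : r * star v = star v := by simpa [hr] using congrArg star (hUr v hv)
    rw [← this, mul_left_of hur, zero_mul]
  have hvu : ∀ v ∈ 𝓤, star v * u = 0 := fun v hv ↦ by
    have : star v * s = star v := by simpa [hs] using congrArg star (hsU v hv)
    rw [← this, mul_assoc, hsu, mul_zero]
  have hoff : IsOffDiagonal q (insert u 𝓤) := by
    refine ⟨?_, ?_, ?_, ?_, ?_⟩
    · rintro v (rfl | hv)
      · rw [mul_assoc, huu, huf]
      · exact hmax.prop.iso v hv
    · rintro v (rfl | hv) w (rfl | hw) hne
      · exact absurd rfl hne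
      · exact huv w hw
      · simpa using congrArg star (huv v hv)
      · exact hmax.prop.right v hv w hw hne
    · rintro v (rfl | hv) w (rfl | hw) hne
      · exact absurd rfl hne
      · simpa using congrArg star (hvu w hw)
      · exact hvu v hv
      · exact hmax.prop.left v hv w hw hne
    · rintro v (rfl | hv) w (rfl | hw)
      · calc u * u = u * q j * (q i * u) := by rw [huq, hqu]
          _ = 0 := by rw [mul_assoc, mul_left_of (h.ortho j i hij.symm), zero_mul, mul_zero]
      · rw [← hsU w hw, mul_left_of hus, zero_mul]
      · rw [← hUr v hv, mul_assoc, hru, mul_zero]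
      · exact hmax.prop.mul v hv w hw
    · rintro v (rfl | hv)
      · exact ⟨i, j, hij, hqu, huq⟩
      · exact hmax.prop.supp v hv
  have hmem : u ∈ 𝓤 := hmax.le_of_ge hoff (Set.subset_insert u 𝓤) (Set.mem_insert u 𝓤)
  have hu0 : u = 0 := by rw [← hUr u hmem, hur]
  rw [hu0, mul_zero] at huu
  exact hf0 huu.symm

theorem conj_sup_le_three (hAW : IsAWStar A) (h : IsPartition q e) {y : A}
    (hy : ∀ n, y * partialSum q n * star y ≤ 1) : y * e * star y ≤ (3 : ℝ) • (1 : A) := by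
  obtain ⟨𝓤, hmax⟩ := exists_maximal_isOffDiagonal q
  have hoff := hmax.prop
  obtain ⟨r, hr, hra, hUr⟩ := hAW.exists_support 𝓤
  obtain ⟨s, hs, hsa, hUs⟩ := hAW.exists_support (star '' 𝓤)
  simp only [Set.forall_mem_image] at hsa hUs
  have hrs := hr.isSelfAdjoint.star_eq
  have hss := hs.isSelfAdjoint.star_eq
  have hsU : ∀ u ∈ 𝓤, s * u = u := fun u hu ↦ by simpa [hss] using congrArg star (hUs hu)
  have hrcomm : ∀ n, r * q n = q n * r := fun n ↦ by
    refine hr.commute_of_support (fun b ↦ (hra b).1) hUr (h.star_eq n) fun u hu ↦ ?_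
    obtain ⟨i, j, hij, hiu, huj⟩ := hoff.supp u hu
    by_cases hn : j = n
    · exact Or.inl (hn ▸ huj)
    · right
      rw [← huj, mul_assoc, h.ortho j n hn, mul_zero]
  have hscomm : ∀ n, s * q n = q n * s := fun n ↦ by
    refine hs.commute_of_support (S := star '' 𝓤)
      (fun b hb ↦ (hsa b).1 fun u hu ↦ hb _ (Set.mem_image_of_mem star hu))
      (by rintro _ ⟨u, hu, rfl⟩; exact hUs hu) (h.star_eq n) ?_
    rintro _ ⟨u, hu, rfl⟩
    obtain ⟨i, j, hij, hiu, huj⟩ := hoff.supp u hu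
    have hui : star u * q i = star u := by simpa [h.star_eq] using congrArg star hiu
    by_cases hn : i = n
    · exact Or.inl (hn ▸ hui)
    · right
      rw [← hui, mul_assoc, h.ortho i n hn, mul_zero]
  have hre : r * e = r := by
    have h1 : r * (1 - e) = 0 := (hra _).1 fun u hu ↦ by
      obtain ⟨i, j, -, -, huj⟩ := hoff.supp u hu
      rw [← huj, mul_assoc, mul_sub, h.mul_sup, mul_one, sub_self, mul_zero]
    rw [mul_sub, mul_one, sub_eq_zero] at h1
    exact h1.symm
  have hse : s * e = s := by
    have h1 : s * (1 - e) = 0 := (hsa _).1 fun u hu ↦ by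
      obtain ⟨i, j, -, hiu, -⟩ := hoff.supp u hu
      have hui : star u * q i = star u := by simpa [h.star_eq] using congrArg star hiu
      rw [← hui, mul_assoc, mul_sub, h.mul_sup, mul_one, sub_self, mul_zero]
    rw [mul_sub, mul_one, sub_eq_zero] at h1
    exact h1.symm
  have her : e * r = r := by simpa [h.star_sup, hrs] using congrArg star hre
  have hes : e * s = s := by simpa [h.star_sup, hss] using congrArg star hse
  have hrs0 : r * s = 0 := by
    refine (hra s).1 fun u hu ↦ ?_
    have h1 : s * star u = 0 := (hsa _).1 fun v hv ↦ by
      rw [← star_mul, hoff.mul u hu v hv, star_zero]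
    simpa [hss] using congrArg star h1
  have hsr0 : s * r = 0 := by simpa [hss, hrs] using congrArg star hrs0
  set t := e - r - s with htdef
  have htr : t * r = 0 := by
    rw [htdef, sub_mul, sub_mul, her, hr.isIdempotentElem.eq, hsr0]; simp
  have hts : t * s = 0 := by
    rw [htdef, sub_mul, sub_mul, hes, hs.isIdempotentElem.eq, hrs0]; simp
  have hte : t * e = t := by
    rw [htdef, sub_mul, sub_mul, h.sup_mul_self, hre, hse]
  have htS : star t = t := by simp [htdef, h.star_sup, hrs, hss]
  have het : e * t = t := by simpa [h.star_sup, htS] using congrArg star hte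
  have ht : IsStarProjection t := by
    refine ⟨?_, htS⟩
    change t * t = t
    conv_lhs => rw [htdef]
    rw [← htdef, mul_sub, mul_sub, hte, htr, hts]; simp
  have htcomm : ∀ n, t * q n = q n * t := fun n ↦ by
    rw [htdef, sub_mul, sub_mul, mul_sub, mul_sub, hrcomm, hscomm, h.sup_mul, h.mul_sup]
  obtain ⟨U, hUU, hUr', hrU⟩ := exists_halving hAW hoff.iso hoff.right hoff.left hoff.mul hr
    fun a ↦ (hra a).1
  obtain ⟨V, hVV, hVs, hsV⟩ := exists_halving hAW (𝓤 := star '' 𝓤)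
    (by
      rintro _ ⟨u, hu, rfl⟩
      simpa [mul_assoc] using congrArg star (hoff.iso u hu))
    (by
      rintro _ ⟨u, hu, rfl⟩ _ ⟨v, hv, rfl⟩ hne
      simpa using hoff.left u hu v hv fun h ↦ hne (h ▸ rfl))
    (by
      rintro _ ⟨u, hu, rfl⟩ _ ⟨v, hv, rfl⟩ hne
      simpa using hoff.right u hu v hv fun h ↦ hne (h ▸ rfl))
    (by
      rintro _ ⟨u, hu, rfl⟩ _ ⟨v, hv, rfl⟩
      rw [← star_mul, hoff.mul v hv u hu, star_zero])
    hs fun a ha ↦ (hsa a).1 fun u hu ↦ ha _ (Set.mem_image_of_mem star hu)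
  have h1 := h.conj_le_one_of_commute hAW hr her hrcomm
    ((h.mul_right hr her hrcomm).noGhost_of_halving hAW hUU hUr' hrU) hy
  have h2 := h.conj_le_one_of_commute hAW hs hes hscomm
    ((h.mul_right hs hes hscomm).noGhost_of_halving hAW hVV hVs hsV) hy
  have h3 := h.conj_le_one_of_commute hAW ht het htcomm
    ((h.mul_right ht het htcomm).noGhost_of_diagonal fun i j hij x ↦
      h.offDiagonal_eq_zero hAW hmax hUr hsU hrs hss ht htr hts htcomm hij x) hy
  calc y * e * star y = y * r * star y + y * s * star y + y * t * star y := by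
        rw [htdef]; noncomm_ring
    _ ≤ 1 + 1 + 1 := add_le_add (add_le_add h1 h2) h3
    _ = (3 : ℝ) • (1 : A) := by
        rw [show (3 : ℝ) = 1 + 1 + 1 by norm_num, add_smul, add_smul, one_smul]

end IsPartition

end OffDiagonal

section Normality

namespace IsPartition

variable {q : ℕ → A} {e : A}

theorem conj_sup_le_three_smul (hAW : IsAWStar A) (h : IsPartition q e) {y a : A}
    (hy : ∀ n, y * partialSum q n * star y ≤ a) : y * e * star y ≤ (3 : ℝ) • a := by
  have ha : 0 ≤ a := by simpa using hy 0
  refine le_of_forall_le_add_smul ((3 : ℝ) • (1 : A)) fun ε hε ↦ ?_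
  rw [smul_comm, ← smul_add]
  obtain ⟨g, z, hg, hz, -, -, -, -, hgg, hzg, hgz⟩ :=
    exists_corner_sqrt (f := (1 : A)) (h := a + ε • 1) (IsStarProjection.one A)
      (one_mul _) (mul_one _) hε (le_add_of_nonneg_left ha)
  have h1 := h.conj_sup_le_three hAW (y := z * y) fun n ↦ by
    have h2 := star_right_conjugate_le_conjugate
      ((hy n).trans (le_add_of_nonneg_right (smul_nonneg hε.le zero_le_one))) z
    have h3 : z * (a + ε • 1) * star z = 1 := by
      rw [hz, ← hgg, ← mul_assoc, hzg, one_mul, hgz]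
    rw [h3] at h2
    simpa [mul_assoc] using h2
  have h2 := star_right_conjugate_le_conjugate h1 g
  have h3 : g * (z * y * e * star (z * y)) * star g = y * e * star y := by
    simp only [star_mul, hg, hz, mul_assoc, hzg, mul_left_of hgz, one_mul, mul_one]
  have h4 : g * ((3 : ℝ) • (1 : A)) * star g = (3 : ℝ) • (a + ε • 1) := by
    rw [mul_smul_comm, smul_mul_assoc, mul_one, hg, hgg]
  rwa [h3, h4] at h2

theorem conj_sup_le (hAW : IsAWStar A) (h : IsPartition q e) {y a : A}
    (hy : ∀ n, y * partialSum q n * star y ≤ a) : y * e * star y ≤ a := by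
  set E := y * e * star y with hE
  set P : ℕ → A := fun n ↦ y * partialSum q n * star y with hP
  have hP0 : ∀ n, 0 ≤ P n := fun n ↦ star_right_conjugate_nonneg (h.proj_partialSum n).nonneg y
  have hE0 : 0 ≤ E := star_right_conjugate_nonneg h.proj_sup.nonneg y
  have key : ∀ (k m : ℕ), (1 - (2 / 3 : ℝ) ^ k) • E + (2 / 3 : ℝ) ^ k • P m ≤ a := by
    intro k
    induction k with
    | zero => exact fun m ↦ by simpa using hy m
    | succ k ih =>
      intro m
      set θ : ℝ := (2 / 3 : ℝ) ^ k with hθ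
      have hθ0 : 0 < θ := by positivity
      set b := a - ((1 - θ) • E + θ • P m) with hb
      have hps := h.star_partialSum m
      have hconj : ∀ w, y * (1 - partialSum q m) * w * star (y * (1 - partialSum q m)) =
          y * ((1 - partialSum q m) * w * (1 - partialSum q m)) * star y := fun w ↦ by
        simp [mul_assoc, hps]
      have h1 := h.conj_sup_le_three_smul hAW (y := y * (1 - partialSum q m)) (a := θ⁻¹ • b)
        fun n ↦ by
          rw [hconj]
          rcases le_total m n with hmn | hmn
          · have h2 : (1 - partialSum q m) * partialSum q n * (1 - partialSum q m) =
                partialSum q n - partialSum q m := by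
              simp only [sub_mul, mul_sub, one_mul, mul_one, h.partialSum_mul_partialSum hmn,
                h.partialSum_mul_partialSum' hmn, (h.proj_partialSum m).isIdempotentElem.eq]
              abel
            have h3 : θ • (P n - P m) ≤ b := by
              rw [hb, smul_sub, sub_add_eq_sub_sub]
              exact sub_le_sub_right (le_sub_iff_add_le'.2 (ih n)) _
            have h4 := smul_le_smul_of_nonneg_left h3 (inv_nonneg.2 hθ0.le)
            rw [smul_smul, inv_mul_cancel₀ hθ0.ne', one_smul] at h4
            rw [h2, mul_sub, sub_mul]
            exact h4
          · have h2 : (1 - partialSum q m) * partialSum q n * (1 - partialSum q m) = 0 := by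
              rw [sub_mul, one_mul, h.partialSum_mul_partialSum hmn, sub_self, zero_mul]
            rw [h2, mul_zero, zero_mul]
            exact smul_nonneg (inv_nonneg.2 hθ0.le) (sub_nonneg.2 (ih m))
      have h2 : (1 - partialSum q m) * e * (1 - partialSum q m) = e - partialSum q m := by
        simp only [sub_mul, mul_sub, one_mul, mul_one, h.partialSum_mul_sup,
          h.sup_mul_partialSum, (h.proj_partialSum m).isIdempotentElem.eq]
        abel
      rw [hconj, h2, mul_sub, sub_mul, smul_smul] at h1
      have h3 := smul_le_smul_of_nonneg_left h1 (show 0 ≤ θ / 3 by positivity)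
      rw [smul_smul, show θ / 3 * (3 * θ⁻¹) = 1 by field_simp, one_smul, hb,
        le_sub_iff_add_le] at h3
      refine le_of_eq_of_le ?_ h3
      change _ = (θ / 3) • (E - P m) + _
      rw [pow_succ, ← hθ]
      module
  refine le_of_forall_le_add_smul E fun ε hε ↦ ?_
  obtain ⟨k, hk⟩ := exists_pow_lt_of_lt_one hε (show (2 / 3 : ℝ) < 1 by norm_num)
  have h1 := (le_add_of_nonneg_right (smul_nonneg (by positivity) (hP0 0))).trans (key k 0)
  rw [sub_smul, one_smul, sub_le_iff_le_add] at h1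
  refine h1.trans ?_
  gcongr

theorem of_monotone {p : ℕ → A} (hp : ∀ n, IsStarProjection (p n))
    (hmono : Monotone p) (he : IsStarProjection e) (hpe : ∀ n, p n ≤ e) (hp0 : p 0 = 0)
    (hann : ∀ a, (∀ n, p n * a = 0) → e * a = 0) :
    IsPartition (fun n ↦ p (n + 1) - p n) e ∧ partialSum (fun n ↦ p (n + 1) - p n) = p := by
  have hsum : partialSum (fun n ↦ p (n + 1) - p n) = p := by
    ext n
    rw [partialSum, Finset.sum_range_sub, hp0, sub_zero]
  have hr : ∀ {m n}, m ≤ n → p n * p m = p m := fun hmn ↦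
    ((hp _).le_iff_mul_eq_right (hp _)).1 (hmono hmn)
  have hl : ∀ {m n}, m ≤ n → p m * p n = p m := fun hmn ↦
    ((hp _).le_iff_mul_eq_left (hp _)).1 (hmono hmn)
  refine ⟨⟨fun n ↦ ((hp _).le_iff_sub (hp _)).1 (hmono n.le_succ), fun i j hij ↦ ?_, he,
    fun n ↦ ?_, fun a ha ↦ hann a fun n ↦ ?_⟩, hsum⟩
  · rcases hij.lt_or_gt with hij | hij
    · simp only [sub_mul, mul_sub, hl (show i ≤ j by omega), hl (show i + 1 ≤ j by omega),
        hl (show i + 1 ≤ j + 1 by omega), hl (show i ≤ j + 1 by omega)]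
      simp
    · simp only [sub_mul, mul_sub, hr (show j ≤ i by omega), hr (show j + 1 ≤ i by omega),
        hr (show j + 1 ≤ i + 1 by omega), hr (show j ≤ i + 1 by omega)]
      simp
  · have h1 : ∀ n, e * p n = p n := fun n ↦ ((hp n).le_iff_mul_eq_right he).1 (hpe n)
    rw [mul_sub, h1, h1]
  · rw [← hsum, partialSum, Finset.sum_mul]
    exact Finset.sum_eq_zero fun i _ ↦ ha i

end IsPartition

omit [PartialOrder A] [StarOrderedRing A] in
/-- In a σ-finite AW*-algebra, the support of a family of elements is the support of a countable
subfamily. -/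
theorem exists_countable_support (hAW : IsAWStar A) (hsf : SigmaFiniteAlg A) (P : Set A) :
    ∃ Q ⊆ P, Q.Countable ∧ ∀ a, (∀ q ∈ Q, q * a = 0) → ∀ p ∈ P, p * a = 0 := by
  let Covered : A → Set A → Prop := fun d Q ↦
    Q ⊆ P ∧ Q.Countable ∧ ∀ a, (∀ q ∈ Q, q * a = 0) → d * a = 0
  let good : Set (Set A) := {F | (∀ d ∈ F, IsStarProjection d ∧ d ≠ 0 ∧ ∃ Q, Covered d Q) ∧
    ∀ c ∈ F, ∀ d ∈ F, c ≠ d → c * d = 0}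
  obtain ⟨F, hF⟩ : ∃ F, Maximal (· ∈ good) F := by
    refine zorn_subset good fun c hc hchain ↦ ⟨⋃₀ c, ⟨?_, ?_⟩, fun s hs ↦
      Set.subset_sUnion_of_mem hs⟩
    · rintro d ⟨F, hF, hd⟩
      exact (hc hF).1 d hd
    · rintro u ⟨F, hF, hu⟩ v ⟨G, hG, hv⟩
      rcases hchain.total hF hG with h | h
      · exact (hc hG).2 u (h hu) v hv
      · exact (hc hF).2 u hu v (h hv)
  have hcount : F.Countable := hsf F (fun d hd ↦ by
    obtain ⟨hd, h0, -⟩ := hF.prop.1 d hd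
    exact ⟨hd.isSelfAdjoint.star_eq, hd.isIdempotentElem.eq, h0⟩) hF.prop.2
  choose! Q hQ using fun d hd ↦ (hF.prop.1 d hd).2.2
  set Q' := ⋃ d ∈ F, Q d with hQ'
  have hQ'P : Q' ⊆ P := Set.iUnion₂_subset fun d hd ↦ (hQ d hd).1
  have hQ'c : Q'.Countable := hcount.biUnion fun d hd ↦ (hQ d hd).2.1
  obtain ⟨s, hs, hsa, hQs⟩ := hAW.exists_support Q'
  suffices hPs : ∀ p ∈ P, p * s = p by
    refine ⟨Q', hQ'P, hQ'c, fun a ha p hp ↦ ?_⟩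
    rw [← hPs p hp, mul_assoc, (hsa a).1 ha, mul_zero]
  by_contra! hcon
  obtain ⟨p, hpP, hps⟩ := hcon
  obtain ⟨s', hs', hsa', hQs'⟩ := hAW.exists_support (insert p Q')
  have hss' : s * s' = s := by
    have h1 : s * (1 - s') = 0 := (hsa _).1 fun u hu ↦ by
      rw [mul_sub, hQs' u (Set.mem_insert_of_mem _ hu), mul_one, sub_self]
    rw [mul_sub, mul_one, sub_eq_zero] at h1
    exact h1.symm
  have hd : IsStarProjection (s' - s) := hs.sub_of_mul_eq_left hs' hss'
  have hd0 : s' - s ≠ 0 := by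
    rw [sub_ne_zero]
    rintro rfl
    exact hps (hQs' p (Set.mem_insert _ _))
  have horth : ∀ d ∈ F, d * (s' - s) = 0 := fun d hdF ↦ by
    refine (hQ d hdF).2.2 _ fun u hu ↦ ?_
    have hu' : u ∈ Q' := Set.mem_biUnion hdF hu
    rw [mul_sub, hQs u hu', hQs' u (Set.mem_insert_of_mem _ hu'), sub_self]
  have horth' : ∀ d ∈ F, (s' - s) * d = 0 := fun d hdF ↦ by
    have h1 := congrArg star (horth d hdF)
    rwa [star_mul, hd.isSelfAdjoint.star_eq,
      (hF.prop.1 d hdF).1.isSelfAdjoint.star_eq, star_zero] at h1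
  have hgood : insert (s' - s) F ∈ good := by
    refine ⟨?_, ?_⟩
    · rintro d (rfl | hdF)
      · refine ⟨hd, hd0, insert p Q', Set.insert_subset hpP hQ'P, hQ'c.insert p, fun a ha ↦ ?_⟩
        rw [sub_mul, (hsa' a).1 ha, (hsa a).1 fun u hu ↦ ha u (Set.mem_insert_of_mem _ hu),
          sub_self]
      · exact hF.prop.1 d hdF
    · rintro c (rfl | hc) d (rfl | hdF) hne
      · exact absurd rfl hne
      · exact horth' d hdF
      · exact horth c hc
      · exact hF.prop.2 c hc d hdF hne
  have hmem : s' - s ∈ F := hF.le_of_ge hgood (Set.subset_insert _ _) (Set.mem_insert _ _)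
  exact hd0 (by rw [← hd.isIdempotentElem.eq]; exact horth _ hmem)

/-- A nonempty directed set in a preorder contains an increasing sequence that dominates a given
sequence of its members. -/
theorem exists_monotone_dominating {α : Type*} [Preorder α] {P : Set α}
    (hdir : ∀ p ∈ P, ∀ q ∈ P, ∃ r ∈ P, p ≤ r ∧ q ≤ r) {c : ℕ → α} (hc : ∀ n, c n ∈ P) :
    ∃ x : ℕ → α, Monotone x ∧ (∀ n, x n ∈ P) ∧ ∀ n, ∃ m, c n ≤ x m := by
  choose! ub hub using hdir
  set x : ℕ → α := fun n ↦ Nat.rec (c 0) (fun n y ↦ ub y (c n)) n with hx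
  have hxP : ∀ n, x n ∈ P := by
    intro n
    induction n with
    | zero => exact hc 0
    | succ n ih => exact (hub _ ih _ (hc n)).1
  exact ⟨x, monotone_nat_of_le_succ fun n ↦ (hub _ (hxP n) _ (hc n)).2.1, hxP,
    fun n ↦ ⟨n + 1, (hub _ (hxP n) _ (hc n)).2.2⟩⟩

end Normality

theorem stmt12 (hAW : IsAWStar A) (hsf : SigmaFiniteAlg A)
    (P : Set A) (hne : P.Nonempty)
    (hproj : ∀ p ∈ P, star p = p ∧ p * p = p)
    (hdir : ∀ p ∈ P, ∀ q ∈ P, ∃ r ∈ P, p ≤ r ∧ q ≤ r) :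
    ∃ s : A, star s = s ∧ (∀ p ∈ P, p ≤ s) ∧
      ∀ t : A, star t = t → (∀ p ∈ P, p ≤ t) → s ≤ t := by
  have hP : ∀ p ∈ P, IsStarProjection p := fun p hp ↦ ⟨(hproj p hp).2, (hproj p hp).1⟩
  obtain ⟨e, he, hea, hPe⟩ := hAW.exists_support P
  have hle : ∀ p ∈ P, p ≤ e := fun p hp ↦ ((hP p hp).le_iff_mul_eq_left he).2 (hPe p hp)
  refine ⟨e, he.isSelfAdjoint.star_eq, hle, fun t _ hPt ↦ ?_⟩
  obtain ⟨Q, hQP, hQc, hQ⟩ := exists_countable_support hAW hsf P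
  obtain ⟨p₀, hp₀⟩ := hne
  obtain ⟨c, hc⟩ := (hQc.insert p₀).exists_eq_range (Set.insert_nonempty _ _)
  have hcP : ∀ n, c n ∈ P := fun n ↦
    Set.insert_subset hp₀ hQP (hc ▸ Set.mem_range_self n)
  obtain ⟨x, hxmono, hxP, hcx⟩ := exists_monotone_dominating hdir hcP
  set y : ℕ → A := fun n ↦ Nat.casesOn n 0 x with hy
  have hyproj : ∀ n, IsStarProjection (y n) := fun n ↦ by
    cases n with
    | zero => exact .zero A
    | succ n => exact hP _ (hxP n)
  have hymono : Monotone y := monotone_nat_of_le_succ fun n ↦ by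
    cases n with
    | zero => exact (hP _ (hxP 0)).nonneg
    | succ n => exact hxmono n.le_succ
  have hyt : ∀ z : A, (∀ p ∈ P, p ≤ z) → ∀ n, y n ≤ z := fun z hz n ↦ by
    cases n with
    | zero => exact (hP p₀ hp₀).nonneg.trans (hz p₀ hp₀)
    | succ n => exact hz _ (hxP n)
  obtain ⟨hpart, hsum⟩ := IsPartition.of_monotone hyproj hymono he (hyt e hle) rfl fun a ha ↦ by
    refine (hea a).1 (hQ a fun u hu ↦ ?_)
    obtain ⟨n, rfl⟩ : u ∈ Set.range c := hc ▸ Set.mem_insert_of_mem _ hu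
    obtain ⟨m, hm⟩ := hcx n
    rw [← ((hP _ (hcP n)).le_iff_mul_eq_left (hP _ (hxP m))).1 hm, mul_assoc]
    exact (congrArg (c n * ·) (ha (m + 1))).trans (mul_zero _)
  have := hpart.conj_sup_le hAW (y := 1) (a := t) fun n ↦ by
    rw [hsum]
    simpa using hyt t hPt n
  simpa using this
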